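/- arXiv:1702.02801 — 2 statements merged into one kernel-verified Lean document; each statement's English description precedes it below -/
import Mathlib

section
/- Let M be a measurable space with a measure μ, let k : M → M be a measurable bijection that preserves μ, and let f₁,…,f_N : M → ℝ be measurable functions orthonormal in L²(μ) whose pointwise linear span H (a subspace of functions M → ℝ) is invariant under composition with k, i.e. fᵢ ∘ k ∈ H for every i. Then for every x ∈ M, Σᵢ₌₁^N fᵢ(k(x))² = Σᵢ₌₁^N fᵢ(x)². -/
open MeasureTheory

/-- If `k` is a measurable measure-preserving bijection of `(M, μ)` and
`f₁, …, f_N` are measurable functions, orthonormal in `L²(μ)`, whose pointwise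
linear span is invariant under composition with `k`, then the sum of squares
`∑ i, f i x ^ 2` is invariant under `k`. -/
theorem sum_sq_comp_eq_of_measurePreserving
    {M : Type*} [MeasurableSpace M] (μ : Measure M) (k : M → M)
    (hkm : Measurable k) (hkb : Function.Bijective k)
    (hkμ : Measure.map k μ = μ)
    (N : ℕ) (f : Fin N → M → ℝ)
    (hfm : ∀ i, Measurable (f i))
    (horth : ∀ i j, ∫ x, f i x * f j x ∂μ = if i = j then (1 : ℝ) else 0)
    (hH : ∀ i, (fun x => f i (k x)) ∈ Submodule.span ℝ (Set.range f)) :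
    ∀ x : M, ∑ i, (f i (k x)) ^ 2 = ∑ i, (f i x) ^ 2 := by
  have hsq : ∀ i, MemLp (f i) 2 μ := by
    intro i
    rw [memLp_two_iff_integrable_sq (hfm i).aestronglyMeasurable]
    by_contra h
    have h1 := horth i i
    have h2 : ∫ x, f i x * f i x ∂μ = 0 := by
      apply integral_undef
      simpa [pow_two] using h
    rw [h2] at h1
    simp at h1
  have hint : ∀ i j, Integrable (fun x => f i x * f j x) μ := fun i j =>
    (hsq i).integrable_mul (hsq j)
  have hA : ∀ i, ∃ c : Fin N → ℝ, ∀ x, f i (k x) = ∑ j, c j * f j x := by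
    intro i
    obtain ⟨c, hc⟩ := (Submodule.mem_span_range_iff_exists_fun ℝ).1 (hH i)
    refine ⟨c, fun x => ?_⟩
    have := congrFun hc x
    simpa using this.symm
  choose A hA using hA
  let B : Matrix (Fin N) (Fin N) ℝ := Matrix.of A
  have hB : B * B.transpose = 1 := by
    ext i j
    rw [Matrix.one_apply, ← horth i j]
    have h1 : ∫ x, f i x * f j x ∂μ = ∫ x, f i (k x) * f j (k x) ∂μ := by
      have h := integral_map (μ := μ) hkm.aemeasurable
        (f := fun x => f i x * f j x) ((hfm i).mul (hfm j)).aestronglyMeasurable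
      rw [hkμ] at h
      exact h
    have h2 : ∀ x, f i (k x) * f j (k x)
        = ∑ a, ∑ b, (A i a * A j b) * (f a x * f b x) := by
      intro x
      rw [hA, hA, Finset.sum_mul_sum]
      refine Finset.sum_congr rfl fun a _ => Finset.sum_congr rfl fun b _ => ?_
      ring
    rw [h1]
    simp_rw [h2]
    rw [integral_finsetSum _ fun a _ => integrable_finsetSum _ fun b _ =>
      (hint a b).const_mul _]
    rw [Matrix.mul_apply]
    refine Finset.sum_congr rfl fun a _ => ?_
    rw [integral_finsetSum _ fun b _ => (hint a b).const_mul _]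
    simp_rw [integral_const_mul, horth]
    simp [B]
  have hB' : B.transpose * B = 1 := mul_eq_one_comm.1 hB
  intro x
  have hv : (fun i => f i (k x)) = B.mulVec (fun i => f i x) := by
    ext i
    rw [hA]
    rfl
  have h3 : (fun i => f i (k x)) ⬝ᵥ (fun i => f i (k x))
      = (fun i => f i x) ⬝ᵥ (fun i => f i x) := by
    rw [hv, Matrix.dotProduct_mulVec, Matrix.vecMul_mulVec, hB', Matrix.vecMul_one]
  simpa [dotProduct, pow_two] using h3
end

section
/- Let E be a nonzero finite-dimensional real inner product space and let G be a group acting on E by linear isometries via a homomorphism ρ : G → O(E). Assume the action is irreducible: every linear subspace W ⊆ E satisfying ρ(g)W ⊆ W for all g ∈ G is either {0} or E. Then every G-invariant symmetric bilinear form B on E (i.e. B(ρ(g)v, ρ(g)w) = B(v,w) for all g, v, w) is a scalar multiple of the inner product: there exists c ∈ ℝ with B(v,w) = c·⟨v,w⟩ for all v, w ∈ E. -/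
open scoped RealInnerProductSpace

/-- A `G`-invariant symmetric bilinear form for an irreducible orthogonal
representation of a group `G` on a nonzero finite-dimensional real inner
product space is a scalar multiple of the inner product. -/
theorem invariant_symm_bilin_eq_smul_inner
    {E : Type*} [NormedAddCommGroup E] [InnerProductSpace ℝ E]
    [FiniteDimensional ℝ E] [Nontrivial E]
    {G : Type*} [Group G] (ρ : G →* (E ≃ₗᵢ[ℝ] E))
    (hirr : ∀ W : Submodule ℝ E, (∀ (g : G), ∀ w ∈ W, ρ g w ∈ W) → W = ⊥ ∨ W = ⊤)
    (B : E →ₗ[ℝ] E →ₗ[ℝ] ℝ)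
    (hsymm : ∀ v w : E, B v w = B w v)
    (hinv : ∀ (g : G) (v w : E), B (ρ g v) (ρ g w) = B v w) :
    ∃ c : ℝ, ∀ v w : E, B v w = c * ⟪v, w⟫ := by
  classical
  let T : E →ₗ[ℝ] E :=
    { toFun := fun v => (InnerProductSpace.toDual ℝ E).symm (LinearMap.toContinuousLinearMap (B v))
      map_add' := fun v w => by simp only [map_add]
      map_smul' := fun a v => by simp }
  have hT : ∀ v w, ⟪T v, w⟫ = B v w := fun v w => by
    simp [T, InnerProductSpace.toDual_symm_apply]
  have hTs : T.IsSymmetric := fun v w => by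
    rw [hT, real_inner_comm, hT, hsymm]
  have hc := hTs.hasEigenvalue_iSup_of_finiteDimensional
  obtain ⟨c, hc⟩ : ∃ c : ℝ, Module.End.HasEigenvalue T c := ⟨_, hc⟩
  obtain ⟨x, hx⟩ := hc.exists_hasEigenvector
  refine ⟨c, ?_⟩
  let W : Submodule ℝ E := LinearMap.ker (B - c • innerₗ E)
  have hW : ∀ v, v ∈ W ↔ ∀ w, B v w = c * ⟪v, w⟫ := fun v => by
    simp [W, LinearMap.mem_ker, LinearMap.ext_iff, sub_eq_zero]
  have hxW : x ∈ W := (hW x).2 fun w => by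
    rw [← hT, hx.apply_eq_smul, real_inner_smul_left]
  rcases hirr W (fun g v hv => (hW _).2 fun w => by
    obtain ⟨u, rfl⟩ := (ρ g).surjective w
    rw [hinv, LinearIsometryEquiv.inner_map_map]
    exact (hW v).1 hv u) with h | h
  · rw [h, Submodule.mem_bot] at hxW
    exact absurd hxW hx.2
  · exact fun v => (hW v).1 (h ▸ Submodule.mem_top)
end
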